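/- arXiv:1802.10178 — 2 statements merged into one kernel-verified Lean document; each statement's English description precedes it below -/
import Mathlib

section
/- Let Z = m_0P_0 + m_1P_1 + m_2P_2 be a fat point scheme at the three coordinate points with nonnegative multiplicities, not all zero (so both ideals are nonzero and proper). Then ρ(I_{P^2}(Z)) ≤ ρ(I_{P^N}(Z)), where I_{P^2}(Z) = ⋂_{i=0}^2 I'(P_i)^{m_i} ⊆ R' and I_{P^N}(Z) = ⋂_{i=0}^2 I(P_i)^{m_i} ⊆ R, with symbolic powers I_{P^2}(Z)^{(m)} = ⋂_i I'(P_i)^{m·m_i} and I_{P^N}(Z)^{(m)} = ⋂_i I(P_i)^{m·m_i}. -/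
/-- The ideal of the `j`-th coordinate point of `P^N`, generated by all
variables `x_i` with `i ≠ j`. -/
noncomputable def ptIdeal (K : Type*) [Field K] (N : ℕ) (j : Fin (N + 1)) :
    Ideal (MvPolynomial (Fin (N + 1)) K) :=
  Ideal.span {f | ∃ i : Fin (N + 1), i ≠ j ∧ f = MvPolynomial.X i}

/-- The ideal of the `j`-th coordinate point of `P^2`, generated by the two
variables `x_i` with `i ≠ j`. -/
noncomputable def ptIdeal3 (K : Type*) [Field K] (j : Fin 3) :
    Ideal (MvPolynomial (Fin 3) K) :=
  Ideal.span {f | ∃ i : Fin 3, i ≠ j ∧ f = MvPolynomial.X i}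

/-- The resurgence `ρ(I) = sup { m/r : I^{(m)} ⊄ I^r }` of an ideal `I` whose
`m`-th symbolic power is `symb m`. -/
noncomputable def resurgence {R : Type*} [CommRing R] (I : Ideal R) (symb : ℕ → Ideal R) : ℝ :=
  sSup {x : ℝ | ∃ m r : ℕ, 0 < m ∧ 0 < r ∧ ¬ symb m ≤ I ^ r ∧ x = (m : ℝ) / (r : ℝ)}

open MvPolynomial in
theorem ptIdeal_eq_span_image (K : Type*) [Field K] (N : ℕ) (j : Fin (N + 1)) :
    ptIdeal K N j = Ideal.span (X '' {i | i ≠ j}) := by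
  refine congrArg Ideal.span (Set.ext fun f => ?_)
  simp [eq_comm]

/-- Every monomial of an element of `I(P_j) ^ k` has degree at least `k` in the variables other
than `x_j`. -/
theorem le_sum_of_mem_support_of_mem_ptIdeal_pow {K : Type*} [Field K] {N : ℕ}
    {j : Fin (N + 1)} {k : ℕ} {f : MvPolynomial (Fin (N + 1)) K} (hf : f ∈ ptIdeal K N j ^ k)
    {a : Fin (N + 1) →₀ ℕ} (ha : a ∈ f.support) : k ≤ ∑ i ∈ Finset.univ.erase j, a i := by
  classical
  induction k generalizing f a with
  | zero => exact Nat.zero_le _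
  | succ k ih =>
    rw [pow_succ] at hf
    induction hf using Submodule.mul_induction_on' generalizing a with
    | mem_mul_mem p hp q hq =>
      obtain ⟨b, hb, c, hc, rfl⟩ := Finset.mem_add.1 (MvPolynomial.support_mul _ _ ha)
      rw [ptIdeal_eq_span_image, MvPolynomial.mem_ideal_span_X_image] at hq
      obtain ⟨i, hi, hci⟩ := hq c hc
      have hle : c i ≤ ∑ l ∈ Finset.univ.erase j, c l :=
        Finset.single_le_sum (f := fun l => c l) (fun _ _ => Nat.zero_le _)
          (Finset.mem_erase.2 ⟨hi, Finset.mem_univ i⟩)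
      have hb' := ih hp hb
      simp only [Finsupp.add_apply, Finset.sum_add_distrib]
      omega
    | add p _ q _ hp hq =>
      rcases Finset.mem_union.1 (MvPolynomial.support_add ha) with h | h
      · exact hp h
      · exact hq h

theorem monomial_mem_ptIdeal_pow {K : Type*} [Field K] {N : ℕ} {j : Fin (N + 1)} {k : ℕ}
    {a : Fin (N + 1) →₀ ℕ} (ha : k ≤ ∑ i ∈ Finset.univ.erase j, a i) :
    MvPolynomial.monomial a (1 : K) ∈ ptIdeal K N j ^ k := by
  refine Ideal.pow_le_pow_right ha ?_
  rw [MvPolynomial.monomial_eq, map_one, one_mul, Finsupp.prod_fintype _ _ (by simp),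
    ← Finset.mul_prod_erase _ _ (Finset.mem_univ j), ← Finset.prod_pow_eq_pow_sum]
  refine Ideal.mul_mem_left _ _ (Ideal.prod_mem_prod fun i hi => Ideal.pow_mem_pow ?_ _)
  exact Ideal.subset_span ⟨i, (Finset.mem_erase.1 hi).1, rfl⟩

/-- A tuple of naturals with sum at least `k` over `s` dominates one with sum exactly `k` over `s`
and total sum `k`. -/
theorem exists_le_sum_eq {σ : Type*} [Fintype σ] (s : Finset σ) (a : σ →₀ ℕ) {k : ℕ}
    (hk : k ≤ ∑ i ∈ s, a i) : ∃ b ≤ a, ∑ i ∈ s, b i = k ∧ ∑ i, b i = k := by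
  classical
  induction k with
  | zero => exact ⟨0, zero_le, by simp, by simp⟩
  | succ k ih =>
    obtain ⟨b, hb, hs, ht⟩ := ih (by omega)
    obtain ⟨i, hi, hlt⟩ := Finset.exists_lt_of_sum_lt (s := s) (f := b) (g := a) (by omega)
    refine ⟨b + Finsupp.single i 1, fun l => ?_, ?_, ?_⟩
    · have := hb l
      by_cases h : i = l
      · subst h; simpa using hlt
      · simpa [h] using this
    · simp [Finset.sum_add_distrib, Finsupp.single_apply, hs, hi]
    · simp [Finset.sum_add_distrib, Finsupp.single_apply, ht]

theorem exists_le_forall_le_sum {σ ι : Type*} [Fintype σ] [Fintype ι] (s : ι → Finset σ)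
    (k : ι → ℕ) (a : σ →₀ ℕ) (hk : ∀ j, k j ≤ ∑ i ∈ s j, a i) :
    ∃ b ≤ a, (∀ j, k j ≤ ∑ i ∈ s j, b i) ∧ ∑ i, b i ≤ ∑ j, k j := by
  classical
  choose b hba hbs hbt using fun j => exists_le_sum_eq (s j) a (hk j)
  refine ⟨Finset.univ.sup b, Finset.sup_le fun j _ => hba j, fun j => ?_, ?_⟩
  · rw [← hbs j]
    exact Finset.sum_le_sum fun i _ => (Finset.le_sup (Finset.mem_univ j) : b j ≤ _) i
  · have hle : Finset.univ.sup b ≤ ∑ j, b j :=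
      Finset.sup_le fun j hj => Finset.single_le_sum (f := b) (fun _ _ => zero_le) hj
    calc ∑ i, (Finset.univ.sup b) i ≤ ∑ i, (∑ j, b j) i := Finset.sum_le_sum fun i _ => hle i
      _ = ∑ j, k j := by
        simp only [Finsupp.finsetSum_apply]
        rw [Finset.sum_comm]
        exact Finset.sum_congr rfl fun j _ => hbt j

theorem monomial_mem_iInf_ptIdeal_pow {K : Type*} [Field K] {N : ℕ} {ι : Type*} [Fintype ι]
    (p : ι → Fin (N + 1)) (k : ι → ℕ) (r : ℕ) {a : Fin (N + 1) →₀ ℕ}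
    (ha : ∀ j, (∑ l, k l) * r * k j ≤ ∑ i ∈ Finset.univ.erase (p j), a i) :
    MvPolynomial.monomial a (1 : K) ∈ (⨅ j, ptIdeal K N (p j) ^ k j) ^ r := by
  induction r generalizing a with
  | zero => simp
  | succ r ih =>
    have hkC : ∀ j, k j ≤ ∑ l, k l := fun j =>
      Finset.single_le_sum (fun _ _ => Nat.zero_le _) (Finset.mem_univ j)
    obtain ⟨b, hba, hb, hbC⟩ := exists_le_forall_le_sum
      (fun j => Finset.univ.erase (p j)) k a (fun j => by
        refine le_trans ?_ (ha j)
        rcases Nat.eq_zero_or_pos (k j) with h | h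
        · simp [h]
        · exact Nat.le_mul_of_pos_left _ (Nat.mul_pos (h.trans_le (hkC j)) r.succ_pos))
    rw [← tsub_add_cancel_of_le hba, ← one_mul (1 : K), ← MvPolynomial.monomial_mul, pow_succ]
    refine Ideal.mul_mem_mul (ih fun j => ?_) ?_
    · have hsum : ∑ i ∈ Finset.univ.erase (p j), (a - b) i + ∑ i ∈ Finset.univ.erase (p j), b i
          = ∑ i ∈ Finset.univ.erase (p j), a i := by
        rw [← Finset.sum_add_distrib]
        exact Finset.sum_congr rfl fun i _ => tsub_add_cancel_of_le (hba i)
      have hbj : ∑ i ∈ Finset.univ.erase (p j), b i ≤ ∑ i, b i :=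
        Finset.sum_le_sum_of_subset (Finset.erase_subset _ _)
      have haj := ha j
      rcases Nat.eq_zero_or_pos (k j) with h | h
      · simp [h]
      · nlinarith [Nat.le_mul_of_pos_right (∑ l, k l) h]
    · exact Ideal.mem_iInf.2 fun j => monomial_mem_ptIdeal_pow (hb j)

/-- A linear containment bound: `I^{(m)} ⊆ I ^ r` as soon as `m` is at least `r` times the sum of
the multiplicities. -/
theorem iInf_ptIdeal_pow_mul_le_pow (K : Type*) [Field K] {N : ℕ} {ι : Type*} [Fintype ι]
    (p : ι → Fin (N + 1)) (k : ι → ℕ) {m r : ℕ} (h : (∑ l, k l) * r ≤ m) :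
    ⨅ j, ptIdeal K N (p j) ^ (m * k j) ≤ (⨅ j, ptIdeal K N (p j) ^ k j) ^ r := by
  intro f hf
  rw [f.as_sum]
  refine Ideal.sum_mem _ fun a ha => ?_
  rw [← mul_one (MvPolynomial.coeff a f), ← MvPolynomial.C_mul_monomial]
  refine Ideal.mul_mem_left _ _ (monomial_mem_iInf_ptIdeal_pow p k r fun j => ?_)
  exact (Nat.mul_le_mul_right _ h).trans
    (le_sum_of_mem_support_of_mem_ptIdeal_pow (Ideal.mem_iInf.1 hf j) ha)

theorem iInf_fin_three {α : Type*} [CompleteLattice α] (f : Fin 3 → α) :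
    ⨅ j, f j = f 0 ⊓ f 1 ⊓ f 2 := by
  refine le_antisymm (le_inf (le_inf (iInf_le f 0) (iInf_le f 1)) (iInf_le f 2))
    (le_iInf fun j => ?_)
  fin_cases j
  · exact inf_le_left.trans inf_le_left
  · exact inf_le_left.trans inf_le_right
  · exact inf_le_right

theorem map_rename_ptIdeal3_le (K : Type*) [Field K] {N : ℕ} {e : Fin 3 → Fin (N + 1)}
    (he : Function.Injective e) (j : Fin 3) :
    (ptIdeal3 K j).map (MvPolynomial.rename e).toRingHom ≤ ptIdeal K N (e j) := by
  refine (Ideal.map_span _ _).trans_le (Ideal.span_le.2 ?_)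
  rintro _ ⟨_, ⟨i, hi, rfl⟩, rfl⟩
  exact Ideal.subset_span ⟨e i, he.ne hi, by simp⟩

theorem map_killCompl_ptIdeal_le (K : Type*) [Field K] {N : ℕ} {e : Fin 3 → Fin (N + 1)}
    (he : Function.Injective e) (j : Fin 3) :
    (ptIdeal K N (e j)).map (MvPolynomial.killCompl (R := K) he).toRingHom ≤ ptIdeal3 K j := by
  refine (Ideal.map_span _ _).trans_le (Ideal.span_le.2 ?_)
  rintro _ ⟨_, ⟨i, hi, rfl⟩, rfl⟩
  by_cases h : i ∈ Set.range e
  · obtain ⟨l, rfl⟩ := h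
    refine Ideal.subset_span ⟨l, fun hl => hi (congrArg e hl), ?_⟩
    simpa using MvPolynomial.killCompl_rename_app (R := K) he (MvPolynomial.X l)
  · simp [MvPolynomial.killCompl, Set.mem_range.not.1 h]

theorem map_iInf_pow_le {R S ι : Type*} [CommRing R] [CommRing S] (φ : R →+* S)
    {I : ι → Ideal R} {J : ι → Ideal S} (h : ∀ j, (I j).map φ ≤ J j) (k : ι → ℕ) :
    (⨅ j, I j ^ k j).map φ ≤ ⨅ j, J j ^ k j :=
  le_iInf fun j => (Ideal.map_mono (iInf_le _ j)).trans
    ((Ideal.map_pow φ _ _).trans_le (Ideal.pow_right_mono (h j) _))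

/-- Containments between ordinary and symbolic powers descend from `P^N` to `P^2`. -/
theorem iInf_ptIdeal3_pow_le_of_iInf_ptIdeal_pow_le {K : Type*} [Field K] {N : ℕ}
    {e : Fin 3 → Fin (N + 1)} (he : Function.Injective e) {k l : Fin 3 → ℕ} {r : ℕ}
    (h : ⨅ j, ptIdeal K N (e j) ^ l j ≤ (⨅ j, ptIdeal K N (e j) ^ k j) ^ r) :
    ⨅ j, ptIdeal3 K j ^ l j ≤ (⨅ j, ptIdeal3 K j ^ k j) ^ r := by
  intro f hf
  have hg := h (map_iInf_pow_le _ (map_rename_ptIdeal3_le K he) l (Ideal.mem_map_of_mem _ hf))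
  have hπ := Ideal.mem_map_of_mem (MvPolynomial.killCompl (R := K) he).toRingHom hg
  rw [Ideal.map_pow] at hπ
  have := Ideal.pow_right_mono (map_iInf_pow_le _ (map_killCompl_ptIdeal_le K he) k) r hπ
  simpa [MvPolynomial.killCompl_rename_app] using this

/-- If `I^{(m)} ⊆ I ^ r` always implies `J^{(m)} ⊆ J ^ r`, and the former holds for `m` at least a
constant multiple of `r`, then `ρ(J) ≤ ρ(I)`. -/
theorem resurgence_le_resurgence {R S : Type*} [CommRing R] [CommRing S] {J : Ideal S}
    {I : Ideal R} {symbJ : ℕ → Ideal S} {symbI : ℕ → Ideal R} (C : ℕ)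
    (hC : ∀ m r, C * r ≤ m → symbI m ≤ I ^ r)
    (h : ∀ m r, symbI m ≤ I ^ r → symbJ m ≤ J ^ r) :
    resurgence J symbJ ≤ resurgence I symbI := by
  refine Real.sSup_le ?_ (Real.sSup_nonneg ?_)
  · rintro x ⟨m, r, hm, hr, hn, rfl⟩
    refine le_csSup ⟨(C : ℝ), ?_⟩ ⟨m, r, hm, hr, fun hc => hn (h m r hc), rfl⟩
    rintro _ ⟨m, r, -, hr, hn, rfl⟩
    rw [div_le_iff₀ (by exact_mod_cast hr)]
    exact_mod_cast (not_le.1 fun hc => hn (hC m r hc)).le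
  · rintro x ⟨m, r, -, -, -, rfl⟩
    positivity

/-- For the three-point fat point scheme `Z = m_0 P_0 + m_1 P_1 + m_2 P_2` (multiplicities
not all zero), `ρ(I_{P^2}(Z)) ≤ ρ(I_{P^N}(Z))`. -/
theorem resurgence_plane_le_resurgence_ambient
    (K : Type*) [Field K] (N : ℕ) (hN : 2 ≤ N) (m0 m1 m2 : ℕ)
    (hne : ¬(m0 = 0 ∧ m1 = 0 ∧ m2 = 0)) :
    resurgence (ptIdeal3 K 0 ^ m0 ⊓ ptIdeal3 K 1 ^ m1 ⊓ ptIdeal3 K 2 ^ m2)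
      (fun m => ptIdeal3 K 0 ^ (m * m0) ⊓ ptIdeal3 K 1 ^ (m * m1) ⊓ ptIdeal3 K 2 ^ (m * m2)) ≤
    resurgence (ptIdeal K N 0 ^ m0 ⊓ ptIdeal K N 1 ^ m1 ⊓ ptIdeal K N 2 ^ m2)
      (fun m => ptIdeal K N 0 ^ (m * m0) ⊓ ptIdeal K N 1 ^ (m * m1) ⊓ ptIdeal K N 2 ^ (m * m2)) := by
  obtain ⟨n, rfl⟩ := Nat.exists_eq_add_of_le' hN
  have he : Function.Injective (![0, 1, 2] : Fin 3 → Fin (n + 2 + 1)) := by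
    have : (![0, 1, 2] : Fin 3 → Fin (n + 2 + 1)) = Fin.castLE (by omega) := by
      funext j
      fin_cases j <;> rfl
    exact this ▸ Fin.castLE_injective _
  have hC := fun m r => iInf_ptIdeal_pow_mul_le_pow K (m := m) (r := r)
    (![0, 1, 2] : Fin 3 → Fin (n + 2 + 1)) ![m0, m1, m2]
  have hD := fun m r => iInf_ptIdeal3_pow_le_of_iInf_ptIdeal_pow_le (K := K) he
    (k := ![m0, m1, m2]) (l := fun j => m * ![m0, m1, m2] j) (r := r)
  simp only [iInf_fin_three] at hC hD
  exact resurgence_le_resurgence _ hC hD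
end

section
/- Let m_0, m_1, m_2 be nonnegative integers with m_2 ≥ max(m_0, m_1) and m_0 + m_1 ≤ m_2. Then for the coordinate points P_0, P_1, P_2 of P^N: I(P_0)^{m_0} ∩ I(P_1)^{m_1} ∩ I(P_2)^{m_2} = (I(P_0)^{m_0} ∩ I(P_2)^{m_0}) · (I(P_1)^{m_1} ∩ I(P_2)^{m_1}) · I(P_2)^{m_2 − m_0 − m_1}, i.e. I(Z) = I(m_0(P_0+P_2)) · I(m_1(P_1+P_2)) · I((m_2−m_0−m_1)P_2). -/
open MvPolynomial

/-- The degree of the exponent `d` in the variables other than `j`, which is the order of vanishing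
of the monomial with exponent `d` at the `j`-th coordinate point. -/
noncomputable def Finsupp.degreeOff {σ : Type*} (j : σ) : (σ →₀ ℕ) →+ ℕ :=
  Finsupp.degree.comp (Finsupp.eraseAddHom j)

theorem Finsupp.degreeOff_single {σ : Type*} [DecidableEq σ] (j i : σ) (n : ℕ) :
    degreeOff j (single i n) = if i = j then 0 else n := by
  split_ifs with h
  · simp [degreeOff, h]
  · simp [degreeOff, Finsupp.erase_single_ne (Ne.symm h)]

theorem Finsupp.degreeOff_add_apply {σ : Type*} (j : σ) (d : σ →₀ ℕ) :
    degreeOff j d + d j = d.degree := by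
  conv_rhs => rw [← Finsupp.erase_add_single j d]
  simp [degreeOff]

/-- If an exponent `d` has orders at least `m + 1`, `n` and `m + 1 + n` at the coordinate points
`p`, `q` and `s`, then a factor of order one at `p` and `s` can be split off,
leaving the order at least `n` at `q`. -/
theorem Finsupp.exists_add_eq_degreeOff_one {σ : Type*} {p q s : σ} (hpq : p ≠ q)
    (hps : p ≠ s) (hqs : q ≠ s) {m n : ℕ} {d : σ →₀ ℕ} (hp : m + 1 ≤ degreeOff p d)
    (hq : n ≤ degreeOff q d) (hs : m + 1 + n ≤ degreeOff s d) :
    ∃ u e : σ →₀ ℕ, u + e = d ∧ degreeOff p u = 1 ∧ degreeOff s u = 1 ∧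
      n ≤ degreeOff q e := by
  classical
  have hdp := degreeOff_add_apply p d
  have hdq := degreeOff_add_apply q d
  have hds := degreeOff_add_apply s d
  have split (u : σ →₀ ℕ) (hu : u ≤ d) (hup : degreeOff p u = 1) (hus : degreeOff s u = 1)
      (huq : n + degreeOff q u ≤ degreeOff q d) : ∃ u e : σ →₀ ℕ, u + e = d ∧
        degreeOff p u = 1 ∧ degreeOff s u = 1 ∧ n ≤ degreeOff q e := by
    obtain ⟨e, rfl⟩ := exists_add_of_le hu
    refine ⟨u, e, rfl, hup, hus, ?_⟩
    rw [map_add] at huq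
    omega
  by_cases hq0 : d q = 0
  · by_cases hr : ∃ i, i ≠ p ∧ i ≠ s ∧ d i ≠ 0
    · obtain ⟨i, hip, his, hi⟩ := hr
      have hiq : i ≠ q := by rintro rfl; exact hi hq0
      refine split (single i 1) (by simpa [Nat.one_le_iff_ne_zero] using hi) ?_ ?_ ?_ <;>
        simp only [degreeOff_single, hip, his, hiq, if_false]
      omega
    · push Not at hr
      have hd : d = single p (d p) + single s (d s) := by
        ext i
        by_cases hip : i = p
        · subst hip; simp [hps.symm]
        · by_cases his : i = s
          · subst his; simp [hps]
          · simp [Ne.symm hip, Ne.symm his, hr i hip his]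
      have hdeg : d.degree = d p + d s := by
        conv_lhs => rw [hd]
        simp
      refine split (single p 1 + single s 1) ?_ ?_ ?_ ?_
      · rw [hd]
        exact add_le_add (single_mono (by omega)) (single_mono (by omega))
      all_goals
        simp only [map_add, degreeOff_single, hps, hps.symm, hpq, hqs.symm, if_true, if_false]
      omega
  · refine split (single q 1) (by simpa [Nat.one_le_iff_ne_zero] using hq0) ?_ ?_ ?_ <;>
      simp [degreeOff_single, hpq.symm, hqs, hq]

/-- Splitting off `exists_add_eq_degreeOff_one` repeatedly: a factor of order exactly `m` at `s` and
at least `m` at `p`, leaving the order at least `n` at `q`. -/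
theorem Finsupp.exists_add_eq_degreeOff {σ : Type*} {p q s : σ} (hpq : p ≠ q)
    (hps : p ≠ s) (hqs : q ≠ s) {m n : ℕ} {d : σ →₀ ℕ} (hp : m ≤ degreeOff p d)
    (hq : n ≤ degreeOff q d) (hs : m + n ≤ degreeOff s d) :
    ∃ u e : σ →₀ ℕ, u + e = d ∧ m ≤ degreeOff p u ∧ degreeOff s u = m ∧
      n ≤ degreeOff q e := by
  induction m generalizing d with
  | zero => exact ⟨0, d, by simp [hq]⟩
  | succ m ih =>
    obtain ⟨u, e, rfl, hup, hus, hqe⟩ := exists_add_eq_degreeOff_one hpq hps hqs hp hq hs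
    rw [map_add] at hp hs
    obtain ⟨v, f, rfl, hvp, hvs, hqf⟩ := ih (d := e) (by omega) hqe (by omega)
    exact ⟨u + v, f, add_assoc u v f, by rw [map_add]; omega, by rw [map_add]; omega, hqf⟩

theorem monomial_mem_ptIdeal_pow_s10 {K : Type*} [Field K] {N : ℕ} {j : Fin (N + 1)} {m : ℕ}
    {d : Fin (N + 1) →₀ ℕ} (h : m ≤ d.degreeOff j) :
    monomial d (1 : K) ∈ ptIdeal K N j ^ m := by
  refine Ideal.pow_le_pow_right h ?_
  clear h
  induction d using Finsupp.induction_linear with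
  | zero => simp
  | add d e hd he =>
    rw [map_add, pow_add, ← one_mul (1 : K), ← monomial_mul]
    exact Ideal.mul_mem_mul hd he
  | single i n =>
    rw [Finsupp.degreeOff_single]
    split_ifs with hij
    · simp
    · rw [← X_pow_eq_monomial]
      have hX : (X i : MvPolynomial (Fin (N + 1)) K) ∈ ptIdeal K N j :=
        Ideal.subset_span ⟨i, hij, rfl⟩
      exact Ideal.pow_mem_pow hX n

theorem le_degreeOff_of_mem_ptIdeal_pow {K : Type*} [Field K] {N : ℕ} {j : Fin (N + 1)} {m : ℕ}
    {f : MvPolynomial (Fin (N + 1)) K} (hf : f ∈ ptIdeal K N j ^ m)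
    {d : Fin (N + 1) →₀ ℕ} (hd : d ∈ f.support) : m ≤ d.degreeOff j := by
  classical
  induction m generalizing f d with
  | zero => exact Nat.zero_le _
  | succ m ih =>
    rw [pow_succ] at hf
    induction hf using Submodule.mul_induction_on' generalizing d with
    | mem_mul_mem g hg h hh =>
      obtain ⟨a, ha, b, hb, rfl⟩ := Finset.mem_add.mp (support_mul g h hd)
      have hspan : ptIdeal K N j = Ideal.span (X '' {i | i ≠ j}) := by
        simp only [ptIdeal, Set.image, Set.mem_ofPred_eq, eq_comm]
      rw [hspan, mem_ideal_span_X_image] at hh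
      obtain ⟨i, hij, hbi⟩ := hh b hb
      have hle : Finsupp.single i 1 ≤ b := by simpa [Nat.one_le_iff_ne_zero] using hbi
      obtain ⟨c, rfl⟩ := exists_add_of_le hle
      have := ih hg ha
      rw [map_add, map_add, Finsupp.degreeOff_single, if_neg hij]
      omega
    | add g _ h _ ihg ihh =>
      exact (Finset.mem_union.mp (support_add hd)).elim (fun hd => ihg hd) fun hd => ihh hd

theorem MvPolynomial.mem_ideal_of_forall_monomial_mem {σ R : Type*} [CommSemiring R]
    {I : Ideal (MvPolynomial σ R)} {f : MvPolynomial σ R}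
    (h : ∀ d ∈ f.support, monomial d 1 ∈ I) : f ∈ I := by
  rw [f.as_sum]
  refine I.sum_mem fun d hd => ?_
  rw [← mul_one (f.coeff d), ← C_mul_monomial]
  exact I.mul_mem_left _ (h d hd)


/-- Splitting of `I(Z)` for `Z = m_0 P_0 + m_1 P_1 + m_2 P_2` at the three coordinate
points of `P^N`, when `max(m_0, m_1) ≤ m_2` and `m_0 + m_1 ≤ m_2`:
`I(Z) = I(m_0(P_0+P_2)) · I(m_1(P_1+P_2)) · I((m_2−m_0−m_1)P_2)`. -/
theorem three_points_splitting_small_case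
    (K : Type*) [Field K] (N : ℕ) (hN : 2 ≤ N) (m0 m1 m2 : ℕ)
    (hmax : max m0 m1 ≤ m2) (hle : m0 + m1 ≤ m2) :
    ptIdeal K N 0 ^ m0 ⊓ ptIdeal K N 1 ^ m1 ⊓ ptIdeal K N 2 ^ m2 =
      (ptIdeal K N 0 ^ m0 ⊓ ptIdeal K N 2 ^ m0) *
        ((ptIdeal K N 1 ^ m1 ⊓ ptIdeal K N 2 ^ m1) *
          ptIdeal K N 2 ^ (m2 - m0 - m1)) := by
  have h01 : (0 : Fin (N + 1)) ≠ 1 := by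
    rw [Ne, Fin.ext_iff, Fin.val_zero, Fin.val_one', Nat.mod_eq_of_lt (by omega)]
    omega
  have h02 : (0 : Fin (N + 1)) ≠ 2 := by
    rw [Ne, Fin.ext_iff, Fin.val_zero, show (2 : Fin (N + 1)).val = 2 % (N + 1) from rfl, Nat.mod_eq_of_lt (by omega)]
    omega
  have h12 : (1 : Fin (N + 1)) ≠ 2 := by
    rw [Ne, Fin.ext_iff, Fin.val_one', show (2 : Fin (N + 1)).val = 2 % (N + 1) from rfl, Nat.mod_eq_of_lt (by omega),
      Nat.mod_eq_of_lt (by omega)]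
    omega
  apply le_antisymm
  · rintro f ⟨⟨hf0, hf1⟩, hf2⟩
    refine mem_ideal_of_forall_monomial_mem fun d hd => ?_
    have hd0 := le_degreeOff_of_mem_ptIdeal_pow hf0 hd
    have hd1 := le_degreeOff_of_mem_ptIdeal_pow hf1 hd
    have hd2 := le_degreeOff_of_mem_ptIdeal_pow hf2 hd
    obtain ⟨u, e, rfl, hu0, hu2, he1⟩ :=
      Finsupp.exists_add_eq_degreeOff h01 h02 h12 hd0 hd1 (hle.trans hd2)
    rw [map_add] at hd2
    obtain ⟨v, w, rfl, hv1, hv2, -⟩ :=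
      Finsupp.exists_add_eq_degreeOff h01.symm h12 h02 he1 (Nat.zero_le _)
        (by omega : m1 + 0 ≤ e.degreeOff 2)
    rw [map_add] at hd2
    have hmon : monomial (u + (v + w)) (1 : K) =
        monomial u 1 * (monomial v 1 * monomial w 1) := by
      simp [monomial_mul]
    rw [hmon]
    exact Ideal.mul_mem_mul
      ⟨monomial_mem_ptIdeal_pow_s10 hu0, monomial_mem_ptIdeal_pow_s10 hu2.ge⟩
      (Ideal.mul_mem_mul ⟨monomial_mem_ptIdeal_pow_s10 hv1, monomial_mem_ptIdeal_pow_s10 hv2.ge⟩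
        (monomial_mem_ptIdeal_pow_s10 (by omega)))
  · refine le_inf (le_inf ?_ ?_) ?_
    · exact Ideal.mul_le_left.trans inf_le_left
    · exact Ideal.mul_le_right.trans (Ideal.mul_le_left.trans inf_le_left)
    · have hm : m2 = m0 + (m1 + (m2 - m0 - m1)) := by omega
      conv_rhs => rw [hm, pow_add, pow_add]
      exact Ideal.mul_mono inf_le_right (Ideal.mul_mono inf_le_right le_rfl)
end
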